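/- arXiv:1002.4704 — 2 statements merged into one kernel-verified Lean document; each statement's English description precedes it below -/
import Mathlib

section
/- Let D and H be Bott equivalent acyclic digraphs on n vertices. Then for every subset I of {0,1,…,n−1}, ρ_D(∪_{i∈I} L_i(D)) = ρ_H(∪_{i∈I} L_i(H)), where ρ_D(X) denotes the rank over 𝔽₂ of the submatrix of the adjacency matrix A_D whose rows are indexed by X and whose columns are indexed by V(D)∖X. -/
/-!
Digraphs on a finite vertex set `V` are modelled as irreflexive relations,
encoded as functions `V → V → Bool`.
-/

variable {V : Type*} [Fintype V] [DecidableEq V]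

/-- The in-neighborhood `N⁻_D(v)` of a vertex `v`. -/
def inN (D : V → V → Bool) (v : V) : Finset V :=
  Finset.univ.filter fun u => D u v = true

/-- The out-neighborhood `N⁺_D(v)` of a vertex `v`. -/
def outN (D : V → V → Bool) (v : V) : Finset V :=
  Finset.univ.filter fun w => D v w = true

/-- The out-degree `deg⁺_D(v)` of a vertex `v`. -/
def outDeg (D : V → V → Bool) (v : V) : ℕ := (outN D v).card

/-- Local complementation `D*v`: for each pair `(u,w) ∈ N⁻_D(v) × N⁺_D(v)` with
`u ≠ w`, the arc `(u,w)` is toggled. -/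
def localComp (D : V → V → Bool) (v : V) : V → V → Bool :=
  fun u w => if u ≠ w ∧ D u v = true ∧ D v w = true then !(D u w) else D u w

/-- The slide `D Δ vw`: the out-neighborhood of `w` is replaced by the symmetric
difference `N⁺_D(w) Δ N⁺_D(v)`; all other arcs are unchanged. -/
def slide (D : V → V → Bool) (v w : V) : V → V → Bool :=
  fun a b => if a = w then xor (D w b) (D v b) else D a b

/-- A digraph is acyclic if it has no directed cycle, i.e. its transitive
closure is irreflexive. -/
def IsAcyclic (D : V → V → Bool) : Prop :=
  ∀ v, ¬ Relation.TransGen (fun a b => D a b = true) v v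

/-- There is a directed walk (in an acyclic digraph: a directed path) with
exactly `k` arcs ending at `v`. -/
def pathEndB (D : V → V → Bool) : ℕ → V → Bool
  | 0, _ => true
  | k+1, v => decide (∃ u, D u v = true ∧ pathEndB D k u = true)

/-- The `k`-th level `L_k(D)`: the set of vertices `v` such that a longest
directed path ending at `v` has exactly `k` arcs. -/
def level (D : V → V → Bool) (k : ℕ) : Finset V :=
  Finset.univ.filter fun v => pathEndB D k v = true ∧ pathEndB D (k+1) v = false

/-- One step of Bott equivalence on digraphs: a local complementation,
a slide, or a digraph isomorphism. -/
def BottStep (D H : V → V → Bool) : Prop :=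
  (∃ v, H = localComp D v) ∨
  (∃ v w, v ≠ w ∧ inN D v = inN D w ∧ H = slide D v w) ∨
  (∃ e : Equiv.Perm V, ∀ a b, H a b = D (e a) (e b))

/-- Two digraphs are Bott equivalent if one is obtained from the other by a
finite sequence of local complementations, slides and isomorphisms. -/
def BottEquiv (D H : V → V → Bool) : Prop :=
  Relation.ReflTransGen BottStep D H

/-- The adjacency matrix of a digraph, over `𝔽₂ = ZMod 2`. -/
def adjMat (D : V → V → Bool) : Matrix V V (ZMod 2) :=
  fun i j => if D i j = true then 1 else 0

/-- `ρ_D(X,Y)`: the rank over `𝔽₂` of the submatrix `A_D[X,Y]` of the adjacency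
matrix whose rows are indexed by `X` and whose columns are indexed by `Y`. -/
noncomputable def rho2 (A : Matrix V V (ZMod 2)) (X Y : Finset V) : ℕ :=
  (A.submatrix (fun i : {x // x ∈ X} => (i : V))
    (fun j : {x // x ∈ Y} => (j : V))).rank

/-- `ρ_D(X) = ρ_D(X, V ∖ X)`. -/
noncomputable def rho (A : Matrix V V (ZMod 2)) (X : Finset V) : ℕ := rho2 A X Xᶜ

/-- `l` is the level function of `D`: it increases along arcs, and each vertex of positive
level `l x` has an in-neighbor of level `l x - 1`. -/
structure IsLevelFun {V : Type*} (D : V → V → Bool) (l : V → ℕ) : Prop where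
  lt_of_arc : ∀ u x, D u x = true → l u < l x
  exists_pred : ∀ x, l x ≠ 0 → ∃ u, D u x = true ∧ l u + 1 = l x

theorem IsAcyclic.exists_isLevelFun {V : Type*} [Fintype V] {D : V → V → Bool}
    (hD : IsAcyclic D) : ∃ l, IsLevelFun D l := by
  classical
  have : Std.Irrefl (Relation.TransGen fun a b => D a b = true) := ⟨hD⟩
  have hwt : WellFounded (Relation.TransGen fun a b => D a b = true) :=
    Finite.wellFounded_of_trans_of_irrefl _
  have hw : WellFounded (fun a b => D a b = true) :=
    hwt.mono fun _ _ h => Relation.TransGen.single h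
  let F : ∀ x, (∀ y, D y x = true → ℕ) → ℕ := fun x rec =>
    (Finset.univ.filter fun u => D u x = true).attach.sup
      fun u => rec u.1 (Finset.mem_filter.1 u.2).2 + 1
  have hF : ∀ x, hw.fix F x =
      (Finset.univ.filter fun u => D u x = true).sup fun u => hw.fix F u + 1 := by
    intro x
    rw [hw.fix_eq]
    exact Finset.sup_attach _ fun u => hw.fix F u + 1
  refine ⟨hw.fix F, fun u x h => ?_, fun x hx => ?_⟩
  · have hle : hw.fix F u + 1 ≤ hw.fix F x := by
      rw [hF x]
      exact Finset.le_sup (f := fun u => hw.fix F u + 1) (by simpa using h)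
    exact hle
  · have hne : (Finset.univ.filter fun u => D u x = true).Nonempty := by
      rw [Finset.nonempty_iff_ne_empty]
      intro h
      rw [hF x, h] at hx
      exact hx rfl
    obtain ⟨u, hu, he⟩ := Finset.exists_mem_eq_sup _ hne fun u => hw.fix F u + 1
    exact ⟨u, (Finset.mem_filter.1 hu).2, by rw [hF x, he]⟩

theorem IsLevelFun.pathEndB_iff {V : Type*} [Fintype V] [DecidableEq V] {D : V → V → Bool}
    {l : V → ℕ} (h : IsLevelFun D l) (k : ℕ) (v : V) : pathEndB D k v = true ↔ k ≤ l v := by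
  induction k generalizing v with
  | zero => simp [pathEndB]
  | succ k ih =>
    simp only [pathEndB, decide_eq_true_eq, ih]
    constructor
    · rintro ⟨u, hu, hk⟩
      have := h.lt_of_arc u v hu
      omega
    · intro hk
      obtain ⟨u, hu, he⟩ := h.exists_pred v (by omega)
      exact ⟨u, hu, by omega⟩

theorem IsLevelFun.biUnion_level {V : Type*} [Fintype V] [DecidableEq V] {D : V → V → Bool}
    {l : V → ℕ} (h : IsLevelFun D l) (I : Finset ℕ) :
    (I.biUnion fun i => level D i) = Finset.univ.filter fun v => l v ∈ I := by
  ext v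
  simp only [level, Finset.mem_biUnion, Finset.mem_filter, Finset.mem_univ, true_and,
    ← Bool.not_eq_true, h.pathEndB_iff]
  constructor
  · rintro ⟨i, hi, h1, h2⟩
    obtain rfl : i = l v := by omega
    exact hi
  · exact fun hv => ⟨_, hv, le_rfl, by omega⟩

theorem rank_add_mul_row_le {m n R : Type*} [Fintype m] [Fintype n] [CommRing R] [Nontrivial R]
    (B B' : Matrix m n R) (r : m) (c : m → R)
    (h : ∀ i j, B' i j = B i j + c i * B r j) : B'.rank ≤ B.rank := by
  classical
  have : B' = (1 + Matrix.of fun i k => if k = r then c i else 0) * B := by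
    ext i j
    rw [Matrix.add_mul, Matrix.one_mul, Matrix.add_apply, Matrix.mul_apply]
    simp [h]
  rw [this]
  exact Matrix.rank_mul_le_right _ _

/-- Adding multiples of a row to the other rows preserves the rank. -/
theorem rank_add_mul_row {m n R : Type*} [Fintype m] [Fintype n] [CommRing R] [Nontrivial R]
    (B B' : Matrix m n R) (r : m) (c : m → R) (hc : c r = 0)
    (h : ∀ i j, B' i j = B i j + c i * B r j) : B'.rank = B.rank :=
  le_antisymm (rank_add_mul_row_le B B' r c h)
    (rank_add_mul_row_le B' B r (fun i => -c i) fun i j => by simp [h, hc])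

/-- Adding multiples of a column to the other columns preserves the rank. -/
theorem rank_add_mul_col {m n K : Type*} [Fintype m] [Fintype n] [Field K]
    (B B' : Matrix m n K) (r : n) (c : n → K) (hc : c r = 0)
    (h : ∀ i j, B' i j = B i j + B i r * c j) : B'.rank = B.rank := by
  rw [← Matrix.rank_transpose B, ← Matrix.rank_transpose B']
  exact rank_add_mul_row _ _ r c hc fun i j => by simp [h, mul_comm]

theorem IsLevelFun.irrefl {V : Type*} {D : V → V → Bool} {l : V → ℕ} (h : IsLevelFun D l)
    (v : V) : D v v = false := by
  by_contra hv
  exact lt_irrefl _ (h.lt_of_arc v v (by simpa using hv))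

theorem IsLevelFun.localComp {V : Type*} [Fintype V] [DecidableEq V] {D : V → V → Bool}
    {l : V → ℕ} (h : IsLevelFun D l) (v : V) : IsLevelFun (localComp D v) l := by
  constructor
  · intro u x hux
    unfold _root_.localComp at hux
    split_ifs at hux with hc
    · exact (h.lt_of_arc _ _ hc.2.1).trans (h.lt_of_arc _ _ hc.2.2)
    · exact h.lt_of_arc _ _ hux
  · intro x hx
    obtain ⟨u, hu, he⟩ := h.exists_pred x hx
    refine ⟨u, ?_, he⟩
    unfold _root_.localComp
    rw [if_neg, hu]
    rintro ⟨-, h1, h2⟩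
    have := h.lt_of_arc _ _ h1
    have := h.lt_of_arc _ _ h2
    omega

theorem IsLevelFun.rho_localComp {V : Type*} [Fintype V] [DecidableEq V] {D : V → V → Bool}
    {l : V → ℕ} (h : IsLevelFun D l) (v : V) (X : Finset V) :
    rho (adjMat (_root_.localComp D v)) X = rho (adjMat D) X := by
  have key : ∀ u w, adjMat (_root_.localComp D v) u w =
      adjMat D u w + adjMat D u v * adjMat D v w := by
    intro u w
    have hne : D u v = true → D v w = true → u ≠ w := by
      rintro h1 h2 rfl
      exact lt_asymm (h.lt_of_arc _ _ h1) (h.lt_of_arc _ _ h2)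
    simp only [adjMat, _root_.localComp]
    by_cases h1 : D u v = true
    · by_cases h2 : D v w = true
      · by_cases h3 : D u w = true
        · simp [h1, h2, h3, hne h1 h2]
          decide
        · simp [h1, h2, h3, hne h1 h2]
      · simp [h2]
    · simp [h1]
  have hv : adjMat D v v = 0 := by simp [adjMat, h.irrefl v]
  unfold rho rho2
  by_cases hX : v ∈ X
  · exact rank_add_mul_row _ _ ⟨v, hX⟩ (fun i => adjMat D i v) hv fun i j => key i j
  · exact rank_add_mul_col _ _ ⟨v, Finset.mem_compl.2 hX⟩ (fun j => adjMat D v j) hv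
      fun i j => key i j

theorem IsLevelFun.le_of_inN_subset {V : Type*} [Fintype V] [DecidableEq V] {D : V → V → Bool}
    {l : V → ℕ} (h : IsLevelFun D l) {v w : V} (hvw : inN D v ⊆ inN D w) : l v ≤ l w := by
  by_cases hv : l v = 0
  · omega
  obtain ⟨u, hu, he⟩ := h.exists_pred v hv
  have hw : u ∈ inN D w := hvw (by simpa [inN] using hu)
  have := h.lt_of_arc u w (by simpa [inN] using hw)
  omega

theorem IsLevelFun.eq_of_inN_eq {V : Type*} [Fintype V] [DecidableEq V] {D : V → V → Bool}
    {l : V → ℕ} (h : IsLevelFun D l) {v w : V} (hvw : inN D v = inN D w) : l v = l w :=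
  le_antisymm (h.le_of_inN_subset hvw.subset) (h.le_of_inN_subset hvw.symm.subset)

theorem IsLevelFun.slide {V : Type*} [Fintype V] [DecidableEq V] {D : V → V → Bool}
    {l : V → ℕ} (h : IsLevelFun D l) {v w : V} (hne : v ≠ w) (hl : l v = l w) :
    IsLevelFun (slide D v w) l := by
  constructor
  · intro a b hab
    unfold _root_.slide at hab
    split_ifs at hab with ha
    · subst ha
      cases hb : D v b with
      | true => exact hl ▸ h.lt_of_arc _ _ hb
      | false => exact h.lt_of_arc _ _ (by simpa [hb] using hab)
    · exact h.lt_of_arc _ _ hab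
  · intro x hx
    obtain ⟨u, hu, he⟩ := h.exists_pred x hx
    by_cases huw : u = w
    · subst huw
      cases hv : D v x with
      | true => exact ⟨v, by simp [_root_.slide, hne, hv], by omega⟩
      | false => exact ⟨u, by simp [_root_.slide, hu, hv], he⟩
    · exact ⟨u, by simp [_root_.slide, huw, hu], he⟩

theorem rho_slide {V : Type*} [Fintype V] [DecidableEq V] (D : V → V → Bool) {v w : V}
    (hne : v ≠ w) (X : Finset V) (hX : w ∈ X → v ∈ X) :
    rho (adjMat (slide D v w)) X = rho (adjMat D) X := by
  have key : ∀ a b, adjMat (slide D v w) a b =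
      adjMat D a b + (if a = w then 1 else 0) * adjMat D v b := by
    intro a b
    by_cases ha : a = w
    · subst ha
      simp only [adjMat, slide]
      cases D a b <;> cases D v b <;> simp; decide
    · simp [adjMat, slide, ha]
  unfold rho rho2
  by_cases hw : w ∈ X
  · exact rank_add_mul_row _ _ ⟨v, hX hw⟩ (fun i => if (i : V) = w then 1 else 0)
      (by simp [hne]) fun i j => key i j
  · congr 1
    ext i j
    have hi : (i : V) ≠ w := fun hi => hw (hi ▸ i.2)
    simp [key, hi]

theorem rho_perm {V : Type*} [Fintype V] [DecidableEq V] {A B : Matrix V V (ZMod 2)}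
    (e : Equiv.Perm V) (h : ∀ a b, B a b = A (e a) (e b)) {X Y : Finset V}
    (hXY : ∀ a, a ∈ Y ↔ e a ∈ X) : rho B Y = rho A X := by
  unfold rho rho2
  have hc : ∀ a, a ∈ Yᶜ ↔ e a ∈ Xᶜ := fun a => by simp [hXY]
  rw [← Matrix.rank_submatrix _ (e.subtypeEquiv hXY) (e.subtypeEquiv hc)]
  congr 1
  ext i j
  exact h i j

theorem IsLevelFun.exists_of_bottStep {V : Type*} [Fintype V] [DecidableEq V]
    {D H : V → V → Bool} {l : V → ℕ} (h : IsLevelFun D l) (hs : BottStep D H) :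
    ∃ l', IsLevelFun H l' ∧ ∀ I : Finset ℕ,
      rho (adjMat H) (Finset.univ.filter fun v => l' v ∈ I) =
        rho (adjMat D) (Finset.univ.filter fun v => l v ∈ I) := by
  rcases hs with ⟨v, rfl⟩ | ⟨v, w, hne, hN, rfl⟩ | ⟨e, he⟩
  · exact ⟨l, h.localComp v, fun I => h.rho_localComp v _⟩
  · have hl := h.eq_of_inN_eq hN
    exact ⟨l, h.slide hne hl, fun I => rho_slide D hne _ (by simp [hl])⟩
  · refine ⟨l ∘ e, ⟨fun u x hux => h.lt_of_arc _ _ (he u x ▸ hux), fun x hx => ?_⟩,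
      fun I => rho_perm e (fun a b => by simp [adjMat, he]) (by simp)⟩
    obtain ⟨u, hu, hul⟩ := h.exists_pred (e x) hx
    exact ⟨e.symm u, by simpa [he] using hu, by simpa using hul⟩

theorem IsLevelFun.exists_of_bottEquiv {V : Type*} [Fintype V] [DecidableEq V]
    {D H : V → V → Bool} {l : V → ℕ} (h : IsLevelFun D l) (hs : BottEquiv D H) :
    ∃ l', IsLevelFun H l' ∧ ∀ I : Finset ℕ,
      rho (adjMat H) (Finset.univ.filter fun v => l' v ∈ I) =
        rho (adjMat D) (Finset.univ.filter fun v => l v ∈ I) := by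
  induction hs with
  | refl => exact ⟨l, h, fun _ => rfl⟩
  | tail _ hstep ih =>
    obtain ⟨l₁, h₁, e₁⟩ := ih
    obtain ⟨l₂, h₂, e₂⟩ := h₁.exists_of_bottStep hstep
    exact ⟨l₂, h₂, fun I => (e₂ I).trans (e₁ I)⟩

/-- If `D` and `H` are Bott equivalent acyclic digraphs on `n`
vertices, then for every subset `I` of `{0,1,…,n-1}`,
`ρ_D(∪_{i∈I} L_i(D)) = ρ_H(∪_{i∈I} L_i(H))`. -/
theorem rho_levels_bottEquiv (n : ℕ) (D H : Fin n → Fin n → Bool)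
    (hD : IsAcyclic D) (hH : IsAcyclic H) (hBE : BottEquiv D H)
    (I : Finset ℕ) (hI : I ⊆ Finset.range n) :
    rho (adjMat D) (I.biUnion fun i => level D i) =
      rho (adjMat H) (I.biUnion fun i => level H i) := by
  obtain ⟨l, h⟩ := hD.exists_isLevelFun
  obtain ⟨l', h', e⟩ := h.exists_of_bottEquiv hBE
  rw [h.biUnion_level, h'.biUnion_level, e]
end

section
/- Let D and H be Bott equivalent acyclic digraphs on n vertices. Then for every i ∈ {0,1,…,n−2}, ρ_D(L_i(D), L_{i+1}(D)) = ρ_H(L_i(H), L_{i+1}(H)), where ρ_D(X,Y) denotes the rank over 𝔽₂ of the submatrix of A_D with rows indexed by X and columns indexed by Y. -/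
/-!
Digraphs on a finite vertex set `V` are modelled as irreflexive relations,
encoded as functions `V → V → Bool`.
-/

variable {V : Type*} [Fintype V] [DecidableEq V]

lemma pathEndB_succ_iff (D : V → V → Bool) (k : ℕ) (v : V) :
    pathEndB D (k + 1) v = true ↔ ∃ u, D u v = true ∧ pathEndB D k u = true := by
  simp [pathEndB]

lemma pathEndB_of_succ (D : V → V → Bool) (k : ℕ) (v : V)
    (h : pathEndB D (k + 1) v = true) : pathEndB D k v = true := by
  induction k generalizing v with
  | zero => rfl
  | succ k ih =>
    obtain ⟨u, huv, hu⟩ := (pathEndB_succ_iff D (k + 1) v).1 h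
    exact (pathEndB_succ_iff D k v).2 ⟨u, huv, ih u hu⟩

lemma level_congr {D H : V → V → Bool} (h : ∀ k x, pathEndB H k x = pathEndB D k x) (k : ℕ) :
    level H k = level D k := by
  simp only [level, h]

lemma mem_level {D : V → V → Bool} {k : ℕ} {v : V} :
    v ∈ level D k ↔ pathEndB D k v = true ∧ pathEndB D (k + 1) v = false := by
  simp [level]

lemma pathEndB_localComp {D : V → V → Bool} {v : V} (hv : D v v = false) (k : ℕ) (x : V) :
    pathEndB (localComp D v) k x = pathEndB D k x := by
  induction k generalizing x with
  | zero => rfl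
  | succ k ih =>
    rw [Bool.eq_iff_iff, pathEndB_succ_iff, pathEndB_succ_iff]
    simp only [ih]
    have key : ∀ u, D u v = true → pathEndB D k u = true → pathEndB D k v = true :=
      fun u huv hu => pathEndB_of_succ D k v ((pathEndB_succ_iff D k v).2 ⟨u, huv, hu⟩)
    constructor
    · rintro ⟨u, hux, hu⟩
      by_cases h : u ≠ x ∧ D u v = true ∧ D v x = true
      · exact ⟨v, h.2.2, key u h.2.1 hu⟩
      · exact ⟨u, by simpa only [localComp, if_neg h] using hux, hu⟩
    · rintro ⟨u, hux, hu⟩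
      by_cases h : u ≠ x ∧ D u v = true ∧ D v x = true
      · exact ⟨v, by simp [localComp, hv, h.2.2], key u h.2.1 hu⟩
      · exact ⟨u, by simpa only [localComp, if_neg h] using hux, hu⟩

lemma apply_eq_of_inN_eq {D : V → V → Bool} {v w : V} (h : inN D v = inN D w) (u : V) :
    D u v = D u w := by
  have := congrArg (u ∈ ·) h
  simpa [inN, ← Bool.eq_iff_iff] using this

lemma pathEndB_eq_of_inN_eq {D : V → V → Bool} {v w : V} (h : inN D v = inN D w) (k : ℕ) :
    pathEndB D k v = pathEndB D k w := by
  cases k with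
  | zero => rfl
  | succ k => simp only [pathEndB, apply_eq_of_inN_eq h]

lemma pathEndB_slide {D : V → V → Bool} {v w : V} (hvw : v ≠ w) (h : inN D v = inN D w)
    (k : ℕ) (x : V) : pathEndB (slide D v w) k x = pathEndB D k x := by
  induction k generalizing x with
  | zero => rfl
  | succ k ih =>
    rw [Bool.eq_iff_iff, pathEndB_succ_iff, pathEndB_succ_iff]
    simp only [ih]
    have key := pathEndB_eq_of_inN_eq h k
    by_cases hvx : D v x = true
    · have hv' : slide D v w v x = true := by simpa [slide, hvw] using hvx
      constructor
      · rintro ⟨u, hux, hu⟩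
        by_cases huw : u = w
        · exact ⟨v, hvx, by rw [key, ← huw, hu]⟩
        · exact ⟨u, by simpa [slide, huw] using hux, hu⟩
      · rintro ⟨u, hux, hu⟩
        by_cases huw : u = w
        · exact ⟨v, hv', by rw [key, ← huw, hu]⟩
        · exact ⟨u, by simpa [slide, huw] using hux, hu⟩
    · have : ∀ u, slide D v w u x = D u x := by
        intro u
        by_cases huw : u = w <;> simp [slide, huw, hvx]
      simp only [this]

lemma pathEndB_perm {D H : V → V → Bool} (e : Equiv.Perm V) (h : ∀ a b, H a b = D (e a) (e b))
    (k : ℕ) (x : V) : pathEndB H k x = pathEndB D k (e x) := by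
  induction k generalizing x with
  | zero => rfl
  | succ k ih =>
    rw [Bool.eq_iff_iff, pathEndB_succ_iff, pathEndB_succ_iff]
    simp only [ih, h]
    exact e.exists_congr_left.trans (by simp)

lemma rho2_congr {A B : Matrix V V (ZMod 2)} {X Y : Finset V}
    (h : ∀ x ∈ X, ∀ y ∈ Y, A x y = B x y) : rho2 A X Y = rho2 B X Y := by
  unfold rho2
  congr 1
  ext a b
  exact h a a.2 b b.2

lemma rho2_localComp {D : V → V → Bool} {v : V} (hv : D v v = false) (i : ℕ) :
    rho2 (adjMat (localComp D v)) (level (localComp D v) i) (level (localComp D v) (i + 1)) =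
      rho2 (adjMat D) (level D i) (level D (i + 1)) := by
  rw [level_congr (pathEndB_localComp hv), level_congr (pathEndB_localComp hv)]
  refine rho2_congr fun u hu w hw => ?_
  have h : ¬ (u ≠ w ∧ D u v = true ∧ D v w = true) := by
    rintro ⟨-, huv, hvw⟩
    have h1 := (pathEndB_succ_iff D i v).2 ⟨u, huv, (mem_level.1 hu).1⟩
    have h2 := (pathEndB_succ_iff D (i + 1) w).2 ⟨v, hvw, h1⟩
    simp [(mem_level.1 hw).2] at h2
  simp only [adjMat, localComp, if_neg h]

lemma rho2_slide {D : V → V → Bool} {v w : V} (hvw : v ≠ w) (h : inN D v = inN D w) (i : ℕ) :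
    rho2 (adjMat (slide D v w)) (level (slide D v w) i) (level (slide D v w) (i + 1)) =
      rho2 (adjMat D) (level D i) (level D (i + 1)) := by
  rw [level_congr (pathEndB_slide hvw h), level_congr (pathEndB_slide hvw h)]
  by_cases hw : w ∈ level D i
  · have hv : v ∈ level D i := by
      simpa only [mem_level, pathEndB_eq_of_inN_eq h] using hw
    have hne : (⟨w, hw⟩ : {x // x ∈ level D i}) ≠ ⟨v, hv⟩ :=
      fun hh => hvw (congrArg Subtype.val hh).symm
    unfold rho2
    rw [← Matrix.rank_mul_eq_right_of_isUnit_det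
      (Matrix.transvection (⟨w, hw⟩ : {x // x ∈ level D i}) ⟨v, hv⟩ (1 : ZMod 2))
      ((adjMat D).submatrix _ _) (by simp [Matrix.det_transvection_of_ne _ _ hne])]
    congr 1
    ext a b
    by_cases ha : a = ⟨w, hw⟩
    · subst ha
      rw [Matrix.transvection_mul_apply_same]
      have h2 : (1 : ZMod 2) + 1 = 0 := by decide
      cases h3 : D w b <;> cases h4 : D v b <;> simp [adjMat, slide, h3, h4, h2]
    · have ha' : (a : V) ≠ w := fun hh => ha (Subtype.ext hh)
      rw [Matrix.transvection_mul_apply_of_ne _ _ _ _ ha]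
      simp [adjMat, slide, ha']
  · refine rho2_congr fun a ha b _ => ?_
    have : a ≠ w := fun hh => hw (hh ▸ ha)
    simp [adjMat, slide, this]

lemma rho2_perm {D H : V → V → Bool} (e : Equiv.Perm V) (h : ∀ a b, H a b = D (e a) (e b))
    (i : ℕ) :
    rho2 (adjMat H) (level H i) (level H (i + 1)) =
      rho2 (adjMat D) (level D i) (level D (i + 1)) := by
  have hl : ∀ k x, x ∈ level H k ↔ e x ∈ level D k := fun k x => by
    simp only [mem_level, pathEndB_perm e h]
  unfold rho2
  rw [← Matrix.rank_submatrix _ (e.subtypeEquiv (hl i)) (e.subtypeEquiv (hl (i + 1)))]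
  congr 1
  ext a b
  simp [adjMat, h]

lemma BottStep.irrefl {D H : V → V → Bool} (hD : ∀ v, D v v = false) (hs : BottStep D H) (u : V) :
    H u u = false := by
  rcases hs with ⟨v, rfl⟩ | ⟨v, w, -, h, rfl⟩ | ⟨e, h⟩
  · simp [localComp, hD]
  · by_cases hu : u = w
    · subst hu
      simp [slide, hD, ← apply_eq_of_inN_eq h]
    · simp [slide, hu, hD]
  · rw [h, hD]

lemma BottStep.rho2_level_eq {D H : V → V → Bool} (hD : ∀ v, D v v = false) (hs : BottStep D H)
    (i : ℕ) :
    rho2 (adjMat H) (level H i) (level H (i + 1)) =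
      rho2 (adjMat D) (level D i) (level D (i + 1)) := by
  rcases hs with ⟨v, rfl⟩ | ⟨v, w, hvw, h, rfl⟩ | ⟨e, h⟩
  · exact rho2_localComp (hD v) i
  · exact rho2_slide hvw h i
  · exact rho2_perm e h i

lemma BottEquiv.rho2_level_eq {D H : V → V → Bool} (hD : ∀ v, D v v = false)
    (hBE : BottEquiv D H) (i : ℕ) :
    rho2 (adjMat D) (level D i) (level D (i + 1)) =
      rho2 (adjMat H) (level H i) (level H (i + 1)) := by
  suffices (∀ v, H v v = false) ∧ rho2 (adjMat D) (level D i) (level D (i + 1)) =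
      rho2 (adjMat H) (level H i) (level H (i + 1)) from this.2
  induction hBE with
  | refl => exact ⟨hD, rfl⟩
  | tail _ hs ih => exact ⟨hs.irrefl ih.1, ih.2.trans (hs.rho2_level_eq ih.1 i).symm⟩

/-- If `D` and `H` are Bott equivalent acyclic digraphs on `n`
vertices, then for every `i ∈ {0,1,…,n-2}`,
`ρ_D(L_i(D), L_{i+1}(D)) = ρ_H(L_i(H), L_{i+1}(H))`. -/
theorem rho_consecutive_levels_bottEquiv (n : ℕ) (D H : Fin n → Fin n → Bool)
    (hD : IsAcyclic D) (hH : IsAcyclic H) (hBE : BottEquiv D H)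
    (i : ℕ) (hi : i + 2 ≤ n) :
    rho2 (adjMat D) (level D i) (level D (i + 1)) =
      rho2 (adjMat H) (level H i) (level H (i + 1)) := by
  have hirr : ∀ v, D v v = false := fun v => by
    rw [← Bool.not_eq_true]
    exact fun h => hD v (Relation.TransGen.single h)
  exact hBE.rho2_level_eq hirr i
end
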